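/- Let n ≥ 1, let Q = [0,1)^n with Lebesgue measure, let p > 1, let f, F be reals with 0 < f^p ≤ F, and let z ∈ [1, p/(p-1)] satisfy -(p-1)z^p + p z^{p-1} = f^p/F. Let (φ_m)_{m∈ℕ} be a sequence of nonnegative measurable functions on Q with ∫_Q φ_m = f and ∫_Q φ_m^p = F for every m, and with lim_{m→∞} ∫_Q (Mφ_m)^p = F·z^p. Then for every dyadic subcube I of Q, lim_{m→∞} (1/|I|) ∫_I φ_m = f. -/

import Mathlib

open MeasureTheory Set Filter

noncomputable section

/-- The unit cube `[0,1)^n` in `ℝ^n`. -/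
def unitCube (n : ℕ) : Set (Fin n → ℝ) := Set.univ.pi fun _ => Set.Ico (0:ℝ) 1

/-- A dyadic subcube of the unit cube: a product of intervals
`[k_i 2^{-N}, (k_i+1) 2^{-N})` with `0 ≤ k_i < 2^N`. -/
def IsDyadicCube (n : ℕ) (R : Set (Fin n → ℝ)) : Prop :=
  ∃ (N : ℕ) (k : Fin n → ℕ), (∀ i, k i < 2 ^ N) ∧
    R = Set.univ.pi fun i => Set.Ico ((k i : ℝ) / 2 ^ N) (((k i : ℝ) + 1) / 2 ^ N)

/-- The (localized) dyadic maximal operator on the unit cube: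
`Mφ(x) = sup { (1/|R|) ∫_R φ : x ∈ R, R a dyadic subcube of Q }`. -/
def dyadicMax (n : ℕ) (φ : (Fin n → ℝ) → ℝ) (x : Fin n → ℝ) : ℝ :=
  sSup { a : ℝ | ∃ R : Set (Fin n → ℝ), IsDyadicCube n R ∧ x ∈ R ∧
    a = ((volume R).toReal)⁻¹ * ∫ y in R, φ y }

/-- The dyadic maximal operator localized to a dyadic subcube `J`:
the supremum is taken only over dyadic subcubes contained in `J`. -/
def dyadicMaxIn (n : ℕ) (J : Set (Fin n → ℝ)) (φ : (Fin n → ℝ) → ℝ)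
    (x : Fin n → ℝ) : ℝ :=
  sSup { a : ℝ | ∃ R : Set (Fin n → ℝ), IsDyadicCube n R ∧ R ⊆ J ∧ x ∈ R ∧
    a = ((volume R).toReal)⁻¹ * ∫ y in R, φ y }

/-- Index of the level-`k` dyadic cube containing `x`. -/
def idx (n k : ℕ) (x : Fin n → ℝ) : Fin n → ℕ := fun i => ⌊x i * 2 ^ k⌋₊

/-- Level-`k` dyadic piece with index `j`. -/
def pc (n k : ℕ) (j : Fin n → ℕ) : Set (Fin n → ℝ) := {y | y ∈ unitCube n ∧ idx n k y = j}

/-- Level-`k` average. -/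
def av (n : ℕ) (φ : (Fin n → ℝ) → ℝ) (k : ℕ) (x : Fin n → ℝ) : ℝ :=
  2 ^ (n * k) * ∫ y in pc n k (idx n k x), φ y

/-- Truncated maximal function. -/
def mx (n : ℕ) (φ : (Fin n → ℝ) → ℝ) : ℕ → (Fin n → ℝ) → ℝ
  | 0 => av n φ 0
  | k + 1 => fun x => max (mx n φ k x) (av n φ (k + 1) x)

lemma meas_unitCube (n : ℕ) : MeasurableSet (unitCube n) :=
  MeasurableSet.univ_pi fun _ => measurableSet_Ico

lemma vol_unitCube (n : ℕ) : volume (unitCube n) = 1 := by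
  simp [unitCube, Real.volume_pi_Ico]

lemma meas_idx (n k : ℕ) : Measurable (idx n k) := by
  refine measurable_pi_lambda _ fun i => ?_
  exact Nat.measurable_floor.comp ((measurable_pi_apply i).mul_const _)

lemma meas_pc (n k : ℕ) (j) : MeasurableSet (pc n k j) :=
  (meas_unitCube n).inter (meas_idx n k (measurableSet_singleton j))

lemma pc_subset (n k : ℕ) (j) : pc n k j ⊆ unitCube n := fun _ h => h.1

lemma pc_eq (n k : ℕ) (j : Fin n → ℕ) (hj : ∀ i, j i < 2 ^ k) :
    pc n k j = Set.univ.pi fun i => Set.Ico ((j i : ℝ) / 2 ^ k) (((j i : ℝ) + 1) / 2 ^ k) := by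
  have h2 : (0:ℝ) < 2 ^ k := by positivity
  ext x
  simp only [pc, unitCube, Set.mem_ofPred_eq, Set.mem_univ_pi, Set.mem_Ico]
  constructor
  · rintro ⟨hx, hi⟩ i
    have := congrFun hi i
    simp only [idx] at this
    rw [Nat.floor_eq_iff (mul_nonneg (hx i).1 h2.le)] at this
    rw [div_le_iff₀ h2, lt_div_iff₀ h2]
    exact this
  · intro h
    have hx : ∀ i, 0 ≤ x i ∧ x i < 1 := by
      intro i
      refine ⟨le_trans (by positivity) (h i).1, lt_of_lt_of_le (h i).2 ?_⟩
      rw [div_le_one h2]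
      exact_mod_cast hj i
    refine ⟨hx, ?_⟩
    ext i
    simp only [idx]
    rw [Nat.floor_eq_iff (mul_nonneg (hx i).1 h2.le), ← div_le_iff₀ h2, ← lt_div_iff₀ h2]
    exact h i

lemma idx_lt (n k : ℕ) (x) (hx : x ∈ unitCube n) (i) : idx n k x i < 2 ^ k := by
  have h := hx i (Set.mem_univ _)
  have h2 : (0:ℝ) < 2 ^ k := by positivity
  simp only [idx]
  rw [Nat.floor_lt (mul_nonneg h.1 h2.le)]
  push_cast
  nlinarith [h.2]

lemma vol_pc (n k : ℕ) (j : Fin n → ℕ) (hj : ∀ i, j i < 2 ^ k) :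
    (volume (pc n k j)).toReal = ((2:ℝ) ^ (n * k))⁻¹ := by
  rw [pc_eq n k j hj, Real.volume_pi_Ico_toReal]
  · have : ∀ i, ((j i : ℝ) + 1) / 2 ^ k - (j i : ℝ) / 2 ^ k = ((2:ℝ) ^ k)⁻¹ := by
      intro i; ring
    simp only [this, Finset.prod_const, Finset.card_univ, Fintype.card_fin]
    rw [inv_pow, ← pow_mul, mul_comm]
  · intro i
    simp only
    gcongr
    linarith

lemma idx_succ (n k : ℕ) (x) : idx n k x = fun i => idx n (k + 1) x i / 2 := by
  ext i
  simp only [idx]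
  have := Nat.floor_div_natCast (x i * 2 ^ (k + 1)) 2
  rw [← this]
  congr 1
  push_cast
  ring

lemma idx_zero (n : ℕ) (x) (hx : x ∈ unitCube n) : idx n 0 x = 0 := by
  ext i
  have := idx_lt n 0 x hx i
  simp at this
  simpa using this

lemma av_congr (n φ k) (x y) (h : idx n k x = idx n k y) : av n φ k x = av n φ k y := by
  simp only [av, h]

lemma mx_congr (n φ k) (x y) (h : idx n k x = idx n k y) : mx n φ k x = mx n φ k y := by
  induction k with
  | zero => exact av_congr _ _ _ _ _ h
  | succ k ih =>
    have h' : idx n k x = idx n k y := by rw [idx_succ, idx_succ n k y, h]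
    simp only [mx, ih h', av_congr _ _ _ _ _ h]

lemma meas_of_congr (n k : ℕ) (g : (Fin n → ℝ) → ℝ)
    (hg : ∀ x y, idx n k x = idx n k y → g x = g y) : Measurable g := by
  obtain ⟨G, hG⟩ := (Function.factorsThrough_iff (f := idx n k) g).1 (fun x y h => hg x y h)
  rw [hG]
  exact (Measurable.of_discrete).comp (meas_idx n k)

lemma meas_mx (n φ k) : Measurable (mx n φ k) := meas_of_congr n k _ (mx_congr n φ k)

lemma meas_av (n φ k) : Measurable (av n φ k) := meas_of_congr n k _ (av_congr n φ k)

lemma cube_eq (n k : ℕ) : unitCube n =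
    ⋃ j ∈ Fintype.piFinset (fun _ : Fin n => Finset.range (2 ^ k)), pc n k j := by
  ext x
  simp only [Set.mem_iUnion, Fintype.mem_piFinset, Finset.mem_range, pc, Set.mem_ofPred_eq]
  constructor
  · intro hx
    exact ⟨idx n k x, idx_lt n k x hx, hx, rfl⟩
  · rintro ⟨j, _, h, _⟩; exact h

lemma integral_split (n k : ℕ) (h : (Fin n → ℝ) → ℝ) (hi : IntegrableOn h (unitCube n)) :
    ∫ x in unitCube n, h x =
      ∑ j ∈ Fintype.piFinset (fun _ : Fin n => Finset.range (2 ^ k)), ∫ x in pc n k j, h x := by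
  conv_lhs => rw [cube_eq n k]
  rw [integral_biUnion_finset]
  · intro j _; exact meas_pc n k j
  · intro j _ j' _ hne
    rw [Function.onFun, Set.disjoint_left]
    rintro x ⟨_, h1⟩ ⟨_, h2⟩
    exact hne (h1.symm.trans h2)
  · intro j _; exact hi.mono_set (pc_subset n k j)

/-- Averages act as conditional expectations. -/
lemma integral_av_mul (n k : ℕ) (φ g : (Fin n → ℝ) → ℝ)
    (hg : ∀ x y, idx n k x = idx n k y → g x = g y)
    (h1 : IntegrableOn (fun x => av n φ k x * g x) (unitCube n))
    (h2 : IntegrableOn (fun x => φ x * g x) (unitCube n)) :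
    ∫ x in unitCube n, av n φ k x * g x = ∫ x in unitCube n, φ x * g x := by
  rw [integral_split n k _ h1, integral_split n k _ h2]
  obtain ⟨G, hG⟩ := (Function.factorsThrough_iff (f := idx n k) g).1 (fun x y h => hg x y h)
  refine Finset.sum_congr rfl fun j hj => ?_
  have hj' : ∀ i, j i < 2 ^ k := by simpa using hj
  have e1 : ∫ x in pc n k j, av n φ k x * g x
      = ∫ x in pc n k j, (2 ^ (n * k) * ∫ y in pc n k j, φ y) * G j := by
    refine setIntegral_congr_fun (meas_pc n k j) ?_
    rintro x ⟨_, hx⟩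
    simp only [av, hG, Function.comp, hx]
  have e2 : ∫ x in pc n k j, φ x * g x = ∫ x in pc n k j, φ x * G j := by
    refine setIntegral_congr_fun (meas_pc n k j) ?_
    rintro x ⟨_, hx⟩
    simp only [hG, Function.comp, hx]
  rw [e1, e2, setIntegral_const, integral_mul_const, Measure.real, vol_pc n k j hj', smul_eq_mul]
  field_simp

/-- Pointwise bound for functions constant on level-`k` cubes. -/
lemma le_integral_of_congr (n k : ℕ) (g : (Fin n → ℝ) → ℝ)
    (hg : ∀ x y, idx n k x = idx n k y → g x = g y) (h0 : ∀ x, 0 ≤ g x)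
    (hi : IntegrableOn g (unitCube n)) (x) (hx : x ∈ unitCube n) :
    g x ≤ 2 ^ (n * k) * ∫ y in unitCube n, g y := by
  have h1 : ∫ y in pc n k (idx n k x), g y ≤ ∫ y in unitCube n, g y :=
    setIntegral_mono_set hi (Eventually.of_forall h0) (pc_subset n k _).eventuallyLE
  have h2 : ∫ y in pc n k (idx n k x), g y = ((2:ℝ) ^ (n * k))⁻¹ * g x := by
    have : ∫ y in pc n k (idx n k x), g y = ∫ y in pc n k (idx n k x), g x := by
      refine setIntegral_congr_fun (meas_pc n k _) ?_
      rintro y ⟨_, hy⟩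
      exact hg _ _ hy
    rw [this, setIntegral_const, Measure.real, vol_pc n k _ (idx_lt n k x hx), smul_eq_mul]
  rw [h2, inv_mul_le_iff₀ (by positivity)] at h1
  exact h1

lemma mx_mono (n φ x) : Monotone (fun k => mx n φ k x) :=
  monotone_nat_of_le_succ fun _ => le_max_left _ _

lemma av_le_mx (n φ k x) : av n φ k x ≤ mx n φ k x := by
  cases k with
  | zero => exact le_rfl
  | succ k => exact le_max_right _ _

lemma av_nonneg (n : ℕ) (φ : (Fin n → ℝ) → ℝ) (h0 : ∀ x, 0 ≤ φ x) (k x) : 0 ≤ av n φ k x :=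
  mul_nonneg (by positivity) (integral_nonneg (f := φ) h0)

lemma mx_nonneg (n : ℕ) (φ : (Fin n → ℝ) → ℝ) (h0 : ∀ x, 0 ≤ φ x) (k x) : 0 ≤ mx n φ k x :=
  (av_nonneg n φ h0 k x).trans (av_le_mx n φ k x)

lemma av_le (n : ℕ) (φ : (Fin n → ℝ) → ℝ) (h0 : ∀ x, 0 ≤ φ x)
    (hi : IntegrableOn φ (unitCube n)) (k x) :
    av n φ k x ≤ 2 ^ (n * k) * ∫ y in unitCube n, φ y := by
  unfold av
  gcongr
  · exact Eventually.of_forall h0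
  · exact pc_subset n k _

lemma mx_le (n : ℕ) (φ : (Fin n → ℝ) → ℝ) (h0 : ∀ x, 0 ≤ φ x)
    (hi : IntegrableOn φ (unitCube n)) (k x) :
    mx n φ k x ≤ 2 ^ (n * k) * ∫ y in unitCube n, φ y := by
  induction k with
  | zero => exact av_le n φ h0 hi 0 x
  | succ k ih =>
    refine max_le (ih.trans ?_) (av_le n φ h0 hi _ x)
    have := integral_nonneg (μ := volume.restrict (unitCube n)) (f := φ) h0
    gcongr
    · norm_num
    · omega

lemma mx_zero (n : ℕ) (φ : (Fin n → ℝ) → ℝ) (x) (hx : x ∈ unitCube n) :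
    mx n φ 0 x = ∫ y in unitCube n, φ y := by
  have : pc n 0 0 = unitCube n := by
    ext y
    exact ⟨fun h => h.1, fun h => ⟨h, idx_zero n y h⟩⟩
  simp [mx, av, idx_zero n x hx, this]

lemma exists_av_of_mx (n φ k x) : ∃ i, mx n φ k x = av n φ i x := by
  induction k with
  | zero => exact ⟨0, rfl⟩
  | succ k ih =>
    rcases max_choice (mx n φ k x) (av n φ (k + 1) x) with h | h
    · obtain ⟨i, hi⟩ := ih; exact ⟨i, h.trans hi⟩
    · exact ⟨k + 1, h⟩

lemma isDyadic_pc (n k x) (hx : x ∈ unitCube n) : IsDyadicCube n (pc n k (idx n k x)) :=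
  ⟨k, idx n k x, idx_lt n k x hx, pc_eq n k _ (idx_lt n k x hx)⟩

lemma dyadicMax_eq (n φ x) (hx : x ∈ unitCube n) :
    dyadicMax n φ x = ⨆ k, av n φ k x := by
  unfold dyadicMax iSup
  congr 1
  ext a
  constructor
  · rintro ⟨R, ⟨N, j, hj, hR⟩, hxR, rfl⟩
    rw [← pc_eq n N j hj] at hR
    subst hR
    refine ⟨N, ?_⟩
    simp only [av]
    rw [vol_pc n N j hj, inv_inv, hxR.2]
  · rintro ⟨k, rfl⟩
    refine ⟨_, isDyadic_pc n k x hx, ⟨hx, rfl⟩, ?_⟩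
    rw [vol_pc n k _ (idx_lt n k x hx), inv_inv]
    rfl

lemma tendsto_mx (n φ x) (hx : x ∈ unitCube n) (hb : BddAbove (Set.range fun k => mx n φ k x)) :
    Tendsto (fun k => mx n φ k x) atTop (nhds (dyadicMax n φ x)) := by
  have h := tendsto_atTop_ciSup (mx_mono n φ x) hb
  convert h using 2
  rw [dyadicMax_eq n φ x hx]
  have hb' : BddAbove (Set.range fun k => av n φ k x) := by
    obtain ⟨C, hC⟩ := hb
    refine ⟨C, ?_⟩
    rintro _ ⟨k, rfl⟩
    exact (av_le_mx n φ k x).trans (hC ⟨k, rfl⟩)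
  apply le_antisymm
  · exact ciSup_le fun k => (av_le_mx n φ k x).trans (le_ciSup hb k)
  · refine ciSup_le fun k => ?_
    obtain ⟨i, hi⟩ := exists_av_of_mx n φ k x
    rw [hi]
    exact le_ciSup hb' i

/-- The defect function. -/
def Gf (p a b : ℝ) : ℝ := a ^ p / (p - 1) + b ^ p - p / (p - 1) * (a * b ^ (p - 1))

lemma rpow_split (p a : ℝ) (hp : 1 < p) (ha : 0 ≤ a) : a * a ^ (p - 1) = a ^ p := by
  rcases ha.eq_or_lt with rfl | h
  · rw [Real.zero_rpow (by linarith : p ≠ 0)]; simp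
  · rw [← Real.rpow_one_add' ha (by linarith)]; ring_nf

lemma Gf_ratio (p t b : ℝ) (hp : 1 < p) (ht : 0 ≤ t) (hb : 0 ≤ b) :
    Gf p (t * b) b = b ^ p / (p - 1) * (t ^ p - 1 - p * (t - 1)) := by
  have h1 : p - 1 ≠ 0 := by linarith
  unfold Gf
  rw [Real.mul_rpow ht hb, mul_assoc t b, rpow_split p b hp hb]
  field_simp
  ring

lemma bern_mono (p ε t : ℝ) (hp : 1 < p) (hε : 0 < ε) (ht : 1 + ε ≤ t) :
    (1 + ε) ^ p - 1 - p * ε ≤ t ^ p - 1 - p * (t - 1) := by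
  obtain ⟨r, hr⟩ : ∃ r, t = (1 + ε) * (1 + r) := ⟨t / (1 + ε) - 1, by field_simp; ring⟩
  have hr0 : 0 ≤ r := by
    by_contra h
    push Not at h
    nlinarith
  have h1 : 1 + p * r ≤ (1 + r) ^ p := one_add_mul_self_le_rpow_one_add (by linarith) hp.le
  have h2 : 1 + ε ≤ (1 + ε) ^ p := Real.self_le_rpow_of_one_le (by linarith) hp.le
  rw [hr, Real.mul_rpow (by linarith) (by linarith)]
  have h3 : (1 + ε) ^ p * (1 + p * r) ≤ (1 + ε) ^ p * (1 + r) ^ p := by gcongr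
  have h4 : 0 ≤ p * r * ((1 + ε) ^ p - (1 + ε)) := by
    apply mul_nonneg (mul_nonneg (by linarith) hr0); linarith
  nlinarith

lemma Gf_nonneg (p a b : ℝ) (hp : 1 < p) (hb : 0 ≤ b) (hab : b ≤ a) : 0 ≤ Gf p a b := by
  rcases hb.eq_or_lt with rfl | h
  · unfold Gf
    rw [Real.zero_rpow (by linarith : p - 1 ≠ 0), Real.zero_rpow (by linarith : p ≠ 0)]
    have : 0 ≤ a ^ p := Real.rpow_nonneg hab _
    simp only [mul_zero, sub_zero, add_zero]
    apply div_nonneg this; linarith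
  · have e : a = a / b * b := by field_simp
    have ht : 1 ≤ a / b := by rwa [one_le_div h]
    rw [e, Gf_ratio p _ b hp (by linarith) hb]
    apply mul_nonneg
    · apply div_nonneg (Real.rpow_nonneg hb _); linarith
    · have := one_add_mul_self_le_rpow_one_add (s := a / b - 1) (by linarith) hp.le
      rw [show 1 + (a / b - 1) = a / b by ring] at this
      linarith

lemma tendsto_of_Gf (p f : ℝ) (hp : 1 < p) (hf : 0 < f) (a b : ℕ → ℝ)
    (hab : ∀ m, b m ≤ a m) (hb : Tendsto b atTop (nhds f))
    (hG : Tendsto (fun m => Gf p (a m) (b m)) atTop (nhds 0)) :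
    Tendsto a atTop (nhds f) := by
  have hp1 : 0 < p - 1 := by linarith
  have hb2 : ∀ᶠ m in atTop, f / 2 < b m := hb.eventually (lt_mem_nhds (by linarith))
  have key : Tendsto (fun m => a m / b m) atTop (nhds 1) := by
    rw [tendsto_order]
    constructor
    · intro c hc
      filter_upwards [hb2] with m hm
      refine lt_of_lt_of_le hc ?_
      rw [one_le_div (by linarith)]
      exact hab m
    · intro c hc
      have hu : 0 < (1 + (c - 1)) ^ p - 1 - p * (c - 1) := by
        have := one_add_mul_self_lt_rpow_one_add (s := c - 1) (by linarith) (by linarith) hp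
        linarith
      have hpos : 0 < (f / 2) ^ p / (p - 1) * ((1 + (c - 1)) ^ p - 1 - p * (c - 1)) := by
        positivity
      filter_upwards [hb2, hG.eventually (gt_mem_nhds hpos)] with m hm hm2
      by_contra hcon
      push Not at hcon
      have hbp : 0 < b m := by linarith
      have e : a m = a m / b m * b m := by field_simp
      rw [e, Gf_ratio p _ _ hp (by linarith) hbp.le] at hm2
      have := bern_mono p (c - 1) (a m / b m) hp (by linarith) (by linarith)
      have h5 : (f / 2) ^ p / (p - 1) ≤ (b m) ^ p / (p - 1) := by gcongr
      have h6 : 0 ≤ b m ^ p / (p - 1) := by positivity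
      have := mul_le_mul h5 this hu.le h6
      linarith
  have := key.mul hb
  rw [one_mul] at this
  refine this.congr' ?_
  filter_upwards [hb2] with m hm
  have : b m ≠ 0 := by linarith
  field_simp

lemma Gf_pointwise (p a b A : ℝ) (hp : 1 < p) (ha : 0 ≤ a) (h : a = max b A) :
    p / (p - 1) * (A * (a ^ (p - 1) - b ^ (p - 1))) - (a ^ p - b ^ p) = Gf p a b := by
  have h1 : p - 1 ≠ 0 := by linarith
  have hA : A * (a ^ (p - 1) - b ^ (p - 1)) = a * (a ^ (p - 1) - b ^ (p - 1)) := by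
    rcases max_choice b A with h' | h'
    · rw [h'] at h; rw [h]; simp
    · rw [h'] at h; rw [h]
  rw [hA, mul_sub, rpow_split p a hp ha]
  unfold Gf
  field_simp
  ring

lemma fin_unitCube (n : ℕ) : IsFiniteMeasure (volume.restrict (unitCube n)) :=
  ⟨by rw [Measure.restrict_apply_univ, vol_unitCube]; exact ENNReal.one_lt_top⟩

lemma int_mx_rpow (n : ℕ) (φ : (Fin n → ℝ) → ℝ) (h0 : ∀ x, 0 ≤ φ x)
    (hi : IntegrableOn φ (unitCube n)) (k : ℕ) (q : ℝ) (hq : 0 ≤ q) :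
    IntegrableOn (fun x => mx n φ k x ^ q) (unitCube n) := by
  have := fin_unitCube n
  refine Integrable.of_bound ((meas_mx n φ k).pow_const q).aestronglyMeasurable
    ((2 ^ (n * k) * ∫ y in unitCube n, φ y) ^ q) (Eventually.of_forall fun x => ?_)
  rw [Real.norm_of_nonneg (Real.rpow_nonneg (mx_nonneg n φ h0 k x) _)]
  exact Real.rpow_le_rpow (mx_nonneg n φ h0 k x) (mx_le n φ h0 hi k x) hq

lemma int_mul_mx_rpow (n : ℕ) (φ : (Fin n → ℝ) → ℝ) (h0 : ∀ x, 0 ≤ φ x)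
    (hi : IntegrableOn φ (unitCube n)) (k : ℕ) (q : ℝ) (hq : 0 ≤ q)
    (g : (Fin n → ℝ) → ℝ) (hg : IntegrableOn g (unitCube n)) :
    IntegrableOn (fun x => g x * mx n φ k x ^ q) (unitCube n) := by
  refine Integrable.mul_bdd (c := (2 ^ (n * k) * ∫ y in unitCube n, φ y) ^ q) hg
    ((meas_mx n φ k).pow_const q).aestronglyMeasurable (Eventually.of_forall fun x => ?_)
  rw [Real.norm_of_nonneg (Real.rpow_nonneg (mx_nonneg n φ h0 k x) _)]
  exact Real.rpow_le_rpow (mx_nonneg n φ h0 k x) (mx_le n φ h0 hi k x) hq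

lemma int_av (n : ℕ) (φ : (Fin n → ℝ) → ℝ) (h0 : ∀ x, 0 ≤ φ x)
    (hi : IntegrableOn φ (unitCube n)) (k : ℕ) : IntegrableOn (av n φ k) (unitCube n) := by
  have := fin_unitCube n
  refine Integrable.of_bound (meas_av n φ k).aestronglyMeasurable
    (2 ^ (n * k) * ∫ y in unitCube n, φ y) (Eventually.of_forall fun x => ?_)
  rw [Real.norm_of_nonneg (av_nonneg n φ h0 k x)]
  exact av_le n φ h0 hi k x

/-- The telescoping quantity. -/
def Ph (n : ℕ) (p : ℝ) (φ : (Fin n → ℝ) → ℝ) (k : ℕ) : ℝ :=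
  p / (p - 1) * (∫ x in unitCube n, φ x * mx n φ k x ^ (p - 1)) -
    ∫ x in unitCube n, mx n φ k x ^ p

lemma Gf_int (n : ℕ) (p : ℝ) (hp : 1 < p) (φ : (Fin n → ℝ) → ℝ) (h0 : ∀ x, 0 ≤ φ x)
    (hi : IntegrableOn φ (unitCube n)) (k : ℕ) :
    IntegrableOn (fun x => Gf p (mx n φ (k + 1) x) (mx n φ k x)) (unitCube n) ∧
    Ph n p φ (k + 1) - Ph n p φ k =
      ∫ x in unitCube n, Gf p (mx n φ (k + 1) x) (mx n φ k x) := by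
  have hp1 : 0 ≤ p - 1 := by linarith
  have e : (fun x => Gf p (mx n φ (k + 1) x) (mx n φ k x)) = fun x =>
      p / (p - 1) * (av n φ (k + 1) x * (mx n φ (k + 1) x ^ (p - 1) - mx n φ k x ^ (p - 1)))
        - (mx n φ (k + 1) x ^ p - mx n φ k x ^ p) := by
    funext x
    exact (Gf_pointwise p _ _ _ hp (mx_nonneg n φ h0 (k + 1) x) rfl).symm
  have ia1 := int_mul_mx_rpow n φ h0 hi (k + 1) (p - 1) hp1 _ (int_av n φ h0 hi (k + 1))
  have ia2 := int_mul_mx_rpow n φ h0 hi k (p - 1) hp1 _ (int_av n φ h0 hi (k + 1))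
  have ib1 := int_mul_mx_rpow n φ h0 hi (k + 1) (p - 1) hp1 _ hi
  have ib2 := int_mul_mx_rpow n φ h0 hi k (p - 1) hp1 _ hi
  have ic1 := int_mx_rpow n φ h0 hi (k + 1) p (by linarith)
  have ic2 := int_mx_rpow n φ h0 hi k p (by linarith)
  have ia : IntegrableOn (fun x => av n φ (k + 1) x *
      (mx n φ (k + 1) x ^ (p - 1) - mx n φ k x ^ (p - 1))) (unitCube n) := by
    simp only [mul_sub]; exact ia1.sub ia2
  have ib : IntegrableOn (fun x => φ x *
      (mx n φ (k + 1) x ^ (p - 1) - mx n φ k x ^ (p - 1))) (unitCube n) := by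
    simp only [mul_sub]; exact ib1.sub ib2
  have ic : IntegrableOn (fun x => mx n φ (k + 1) x ^ p - mx n φ k x ^ p) (unitCube n) :=
    ic1.sub ic2
  rw [e]
  refine ⟨(ia.const_mul _).sub ic, ?_⟩
  rw [integral_sub (ia.const_mul _) ic, integral_const_mul, integral_av_mul n (k + 1) φ _ _ ia ib,
    integral_sub ic1 ic2]
  · simp only [mul_sub]
    rw [integral_sub ib1 ib2]
    unfold Ph
    ring
  · intro x y h
    have h' : idx n k x = idx n k y := by rw [idx_succ, idx_succ n k y, h]
    simp only [mx_congr n φ _ _ _ h, mx_congr n φ _ _ _ h']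

lemma Gf_mx_nonneg (n : ℕ) (p : ℝ) (hp : 1 < p) (φ : (Fin n → ℝ) → ℝ) (h0 : ∀ x, 0 ≤ φ x)
    (k : ℕ) (x) : 0 ≤ Gf p (mx n φ (k + 1) x) (mx n φ k x) :=
  Gf_nonneg p _ _ hp (mx_nonneg n φ h0 k x) (mx_mono n φ x (Nat.le_succ k))

lemma Ph_mono (n : ℕ) (p : ℝ) (hp : 1 < p) (φ : (Fin n → ℝ) → ℝ) (h0 : ∀ x, 0 ≤ φ x)
    (hi : IntegrableOn φ (unitCube n)) : Monotone (Ph n p φ) := by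
  refine monotone_nat_of_le_succ fun k => ?_
  have := (Gf_int n p hp φ h0 hi k).2
  have h2 : 0 ≤ ∫ x in unitCube n, Gf p (mx n φ (k + 1) x) (mx n φ k x) :=
    integral_nonneg (Gf_mx_nonneg n p hp φ h0 k)
  linarith

lemma Ph_zero (n : ℕ) (p f : ℝ) (hp : 1 < p) (φ : (Fin n → ℝ) → ℝ) (h0 : ∀ x, 0 ≤ φ x)
    (h1 : ∫ x in unitCube n, φ x = f) : Ph n p φ 0 = f ^ p / (p - 1) := by
  have hf : 0 ≤ f := by rw [← h1]; exact integral_nonneg (f := φ) h0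
  have h : p - 1 ≠ 0 := by linarith
  have e1 : ∫ x in unitCube n, φ x * mx n φ 0 x ^ (p - 1)
      = ∫ x in unitCube n, φ x * f ^ (p - 1) := by
    refine setIntegral_congr_fun (meas_unitCube n) fun x hx => ?_
    simp only [mx_zero n φ x hx, h1]
  have e2 : ∫ x in unitCube n, mx n φ 0 x ^ p = ∫ x in unitCube n, f ^ p := by
    refine setIntegral_congr_fun (meas_unitCube n) fun x hx => ?_
    simp only [mx_zero n φ x hx, h1]
  unfold Ph
  rw [e1, e2, integral_mul_const, h1, rpow_split p f hp hf, setIntegral_const, Measure.real,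
    vol_unitCube]
  simp only [ENNReal.toReal_one, one_smul]
  field_simp
  ring

/-- The bounding function. -/
def psi (p f F X : ℝ) : ℝ :=
  p / (p - 1) * (F ^ (1 / p) * X ^ (1 / (p / (p - 1)))) - X - f ^ p / (p - 1)

lemma Ph_le (n : ℕ) (p f F : ℝ) (hp : 1 < p) (φ : (Fin n → ℝ) → ℝ) (h0 : ∀ x, 0 ≤ φ x)
    (hm : Measurable φ)
    (hi : IntegrableOn φ (unitCube n)) (hip : IntegrableOn (fun x => φ x ^ p) (unitCube n))
    (h2 : ∫ x in unitCube n, φ x ^ p = F) (k : ℕ) :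
    Ph n p φ k - f ^ p / (p - 1) ≤ psi p f F (∫ x in unitCube n, mx n φ k x ^ p) := by
  have := fin_unitCube n
  have hp1 : 0 < p - 1 := by linarith
  have hc : p.HolderConjugate (p / (p - 1)) := Real.HolderConjugate.conjExponent hp
  have hmem : MemLp φ (ENNReal.ofReal p) (volume.restrict (unitCube n)) := by
    rw [← integrable_norm_rpow_iff hm.aestronglyMeasurable (by simp; linarith) (by simp),
      ENNReal.toReal_ofReal (by linarith)]
    refine hip.congr (Eventually.of_forall fun x => ?_)
    simp only [Real.norm_of_nonneg (h0 x)]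
  have hmem2 : MemLp (fun x => mx n φ k x ^ (p - 1)) (ENNReal.ofReal (p / (p - 1)))
      (volume.restrict (unitCube n)) := by
    refine MemLp.of_bound ((meas_mx n φ k).pow_const _).aestronglyMeasurable
      ((2 ^ (n * k) * ∫ y in unitCube n, φ y) ^ (p - 1)) (Eventually.of_forall fun x => ?_)
    rw [Real.norm_of_nonneg (Real.rpow_nonneg (mx_nonneg n φ h0 k x) _)]
    exact Real.rpow_le_rpow (mx_nonneg n φ h0 k x) (mx_le n φ h0 hi k x) hp1.le
  have := integral_mul_le_Lp_mul_Lq_of_nonneg hc (Eventually.of_forall h0)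
    (Eventually.of_forall fun x => Real.rpow_nonneg (mx_nonneg n φ h0 k x) (p - 1)) hmem hmem2
  have e : ∀ x, (mx n φ k x ^ (p - 1)) ^ (p / (p - 1)) = mx n φ k x ^ p := by
    intro x
    rw [← Real.rpow_mul (mx_nonneg n φ h0 k x)]
    congr 1
    field_simp
  simp only [e, h2] at this
  unfold Ph psi
  gcongr

lemma psi_bound (p f F X : ℝ) (hp : 1 < p) (hf : 0 ≤ f) (hF : 0 ≤ F) (hX : 0 ≤ X)
    (h : 0 ≤ psi p f F X) : X ≤ (p / (p - 1) * F ^ (1 / p)) ^ p := by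
  have hp1 : 0 < p - 1 := by linarith
  rcases hX.eq_or_lt with rfl | hX'
  · positivity
  have h1 : 0 ≤ f ^ p / (p - 1) := by positivity
  unfold psi at h
  have h2 : X = X ^ (1 / p) * X ^ (1 / (p / (p - 1))) := by
    rw [← Real.rpow_add hX']
    have : 1 / p + 1 / (p / (p - 1)) = 1 := by field_simp; ring
    rw [this, Real.rpow_one]
  have h3 : X ^ (1 / p) * X ^ (1 / (p / (p - 1))) ≤
      (p / (p - 1) * F ^ (1 / p)) * X ^ (1 / (p / (p - 1))) := by
    rw [← h2]; linarith
  have h4 := le_of_mul_le_mul_right h3 (by positivity)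
  calc X = (X ^ (1 / p)) ^ p := by
        rw [← Real.rpow_mul hX]
        rw [one_div_mul_cancel (by linarith), Real.rpow_one]
    _ ≤ _ := Real.rpow_le_rpow (by positivity) h4 (by linarith)

lemma psi_cont (p f F : ℝ) (hp : 1 < p) : Continuous (psi p f F) := by
  have : 0 ≤ 1 / (p / (p - 1)) := by
    have : 0 < p - 1 := by linarith
    positivity
  unfold psi
  have h := Real.continuous_rpow_const this
  fun_prop

lemma psi_zero (p f F z : ℝ) (hp : 1 < p) (hF : 0 < F) (hz : 0 < z)
    (hzeq : -(p - 1) * z ^ p + p * z ^ (p - 1) = f ^ p / F) : psi p f F (F * z ^ p) = 0 := by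
  have hp1 : 0 < p - 1 := by linarith
  unfold psi
  rw [Real.mul_rpow hF.le (by positivity), ← mul_assoc (F ^ (1 / p)), ← Real.rpow_add hF,
    ← Real.rpow_mul hz.le]
  have e1 : 1 / p + 1 / (p / (p - 1)) = 1 := by field_simp; ring
  have e2 : p * (1 / (p / (p - 1))) = p - 1 := by field_simp
  rw [e1, e2, Real.rpow_one]
  have : f ^ p = F * (-(p - 1) * z ^ p + p * z ^ (p - 1)) := by rw [hzeq]; field_simp
  rw [this]
  field_simp
  ring

lemma tendsto_int_mx (n : ℕ) (p C : ℝ) (hp : 1 < p) (φ : (Fin n → ℝ) → ℝ) (h0 : ∀ x, 0 ≤ φ x)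
    (hi : IntegrableOn φ (unitCube n))
    (hC : ∀ k, ∫ x in unitCube n, mx n φ k x ^ p ≤ C) :
    Tendsto (fun k => ∫ x in unitCube n, mx n φ k x ^ p) atTop
      (nhds (∫ x in unitCube n, dyadicMax n φ x ^ p)) := by
  have hpp : 0 < p := by linarith
  have hmono : ∀ x, Monotone fun k => ENNReal.ofReal (mx n φ k x ^ p) := by
    intro x k l hkl
    exact ENNReal.ofReal_le_ofReal
      (Real.rpow_le_rpow (mx_nonneg n φ h0 k x) (mx_mono n φ x hkl) hpp.le)
  have hmeas : ∀ k, Measurable fun x => ENNReal.ofReal (mx n φ k x ^ p) := fun k =>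
    ((meas_mx n φ k).pow_const p).ennreal_ofReal
  have hlin : ∀ k, ∫⁻ x in unitCube n, ENNReal.ofReal (mx n φ k x ^ p)
      = ENNReal.ofReal (∫ x in unitCube n, mx n φ k x ^ p) := fun k =>
    (ofReal_integral_eq_lintegral_ofReal (int_mx_rpow n φ h0 hi k p hpp.le)
      (Eventually.of_forall fun x => Real.rpow_nonneg (mx_nonneg n φ h0 k x) p)).symm
  have hle : ∀ k, ∫⁻ x in unitCube n, ENNReal.ofReal (mx n φ k x ^ p) ≤ ENNReal.ofReal C :=
    fun k => by rw [hlin]; exact ENNReal.ofReal_le_ofReal (hC k)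
  have hfin : ∀ᵐ x ∂(volume.restrict (unitCube n)),
      (⨆ k, ENNReal.ofReal (mx n φ k x ^ p)) < ⊤ := by
    refine ae_lt_top (Measurable.iSup hmeas) ?_
    rw [lintegral_iSup hmeas (fun k l hkl x => hmono x hkl)]
    exact ne_top_of_le_ne_top ENNReal.ofReal_ne_top (iSup_le hle)
  have hlim : ∀ᵐ x ∂(volume.restrict (unitCube n)),
      Tendsto (fun k => mx n φ k x) atTop (nhds (dyadicMax n φ x)) := by
    filter_upwards [hfin, ae_restrict_mem (meas_unitCube n)] with x hx hxQ
    refine tendsto_mx n φ x hxQ ?_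
    refine ⟨(⨆ k, ENNReal.ofReal (mx n φ k x ^ p)).toReal ^ (1 / p), ?_⟩
    rintro _ ⟨k, rfl⟩
    have hk : mx n φ k x ^ p ≤ (⨆ k, ENNReal.ofReal (mx n φ k x ^ p)).toReal := by
      rw [← ENNReal.ofReal_le_iff_le_toReal hx.ne]
      exact le_iSup (fun k => ENNReal.ofReal (mx n φ k x ^ p)) k
    have hnn := mx_nonneg n φ h0 k x
    calc mx n φ k x = (mx n φ k x ^ p) ^ (1 / p) := by
          rw [← Real.rpow_mul hnn, mul_one_div_cancel hpp.ne', Real.rpow_one]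
      _ ≤ _ := Real.rpow_le_rpow (by positivity) hk (by positivity)
  have hlimp : ∀ᵐ x ∂(volume.restrict (unitCube n)),
      Tendsto (fun k => mx n φ k x ^ p) atTop (nhds (dyadicMax n φ x ^ p)) := by
    filter_upwards [hlim] with x hx
    exact hx.rpow_const (Or.inr hpp.le)
  have hasm : AEStronglyMeasurable (fun x => dyadicMax n φ x ^ p)
      (volume.restrict (unitCube n)) :=
    aestronglyMeasurable_of_tendsto_ae atTop
      (fun k => ((meas_mx n φ k).pow_const p).aestronglyMeasurable) hlimp
  have hnn : 0 ≤ᵐ[volume.restrict (unitCube n)] fun x => dyadicMax n φ x ^ p := by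
    filter_upwards [hlimp] with x hx
    exact ge_of_tendsto' hx fun k => Real.rpow_nonneg (mx_nonneg n φ h0 k x) p
  have hT := lintegral_tendsto_of_tendsto_of_monotone (fun k => (hmeas k).aemeasurable)
    (Eventually.of_forall hmono)
    (hlimp.mono fun x hx => ENNReal.tendsto_ofReal hx)
  have hne : ∫⁻ x in unitCube n, ENNReal.ofReal (dyadicMax n φ x ^ p) ≠ ⊤ :=
    ne_top_of_le_ne_top ENNReal.ofReal_ne_top (le_of_tendsto' hT hle)
  rw [integral_eq_lintegral_of_nonneg_ae hnn hasm]
  refine ((ENNReal.tendsto_toReal hne).comp hT).congr fun k => ?_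
  simp only [Function.comp]
  rw [hlin, ENNReal.toReal_ofReal]
  exact integral_nonneg fun x => Real.rpow_nonneg (mx_nonneg n φ h0 k x) p

/-- The defect estimate. -/
lemma Gf_le_psi (n : ℕ) (p f F : ℝ) (hp : 1 < p) (hF : 0 ≤ F)
    (φ : (Fin n → ℝ) → ℝ) (h0 : ∀ x, 0 ≤ φ x) (hm : Measurable φ)
    (hi : IntegrableOn φ (unitCube n)) (hip : IntegrableOn (fun x => φ x ^ p) (unitCube n))
    (h1 : ∫ x in unitCube n, φ x = f) (h2 : ∫ x in unitCube n, φ x ^ p = F) (k : ℕ) :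
    ∫ x in unitCube n, Gf p (mx n φ (k + 1) x) (mx n φ k x) ≤
      psi p f F (∫ x in unitCube n, dyadicMax n φ x ^ p) := by
  have hf : 0 ≤ f := by rw [← h1]; exact integral_nonneg (f := φ) h0
  have hz := Ph_zero n p f hp φ h0 h1
  have hmono := Ph_mono n p hp φ h0 hi
  have hle := Ph_le n p f F hp φ h0 hm hi hip h2
  have hC : ∀ k, ∫ x in unitCube n, mx n φ k x ^ p ≤ (p / (p - 1) * F ^ (1 / p)) ^ p := by
    intro k
    refine psi_bound p f F _ hp hf hF
      (integral_nonneg fun x => Real.rpow_nonneg (mx_nonneg n φ h0 k x) p) ?_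
    refine le_trans ?_ (hle k)
    have := hmono (Nat.zero_le k)
    linarith
  have hT := ((psi_cont p f F hp).tendsto _).comp (tendsto_int_mx n p _ hp φ h0 hi hC)
  refine ge_of_tendsto hT ?_
  filter_upwards [eventually_ge_atTop (k + 1)] with K hK
  rw [← (Gf_int n p hp φ h0 hi k).2]
  refine le_trans ?_ (hle K)
  have a1 := hmono (Nat.zero_le k)
  have a2 := hmono hK
  linarith

/-- Along any extremal sequence, the averages over every dyadic subcube tend to `f`. -/
theorem extremal_avg_tendsto (n : ℕ) (hn : 1 ≤ n) (p f F z : ℝ) (hp : 1 < p)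
    (hf : 0 < f ^ p) (hfF : f ^ p ≤ F)
    (hz : z ∈ Set.Icc 1 (p / (p - 1)))
    (hzeq : -(p - 1) * z ^ p + p * z ^ (p - 1) = f ^ p / F)
    (φ : ℕ → (Fin n → ℝ) → ℝ)
    (hφ0 : ∀ m x, 0 ≤ φ m x) (hφm : ∀ m, Measurable (φ m))
    (h1 : ∀ m, ∫ x in unitCube n, φ m x = f)
    (h2 : ∀ m, ∫ x in unitCube n, φ m x ^ p = F)
    (h3 : Tendsto (fun m => ∫ x in unitCube n, (dyadicMax n (φ m) x) ^ p)
      atTop (nhds (F * z ^ p))) :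
    ∀ I : Set (Fin n → ℝ), IsDyadicCube n I →
      Tendsto (fun m => (1 / (volume I).toReal) * ∫ x in I, φ m x)
        atTop (nhds f) := by
  have hpp : 0 < p := by linarith
  have hf0 : 0 ≤ f := by rw [← h1 0]; exact integral_nonneg (f := φ 0) (hφ0 0)
  have hfp : 0 < f := by
    rcases hf0.eq_or_lt with h | h
    · rw [← h, Real.zero_rpow hpp.ne'] at hf; exact absurd hf (lt_irrefl _)
    · exact h
  have hF : 0 < F := hf.trans_le hfF
  have hi : ∀ m, IntegrableOn (φ m) (unitCube n) := by
    intro m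
    by_contra h
    have := h1 m
    rw [integral_undef h] at this
    linarith
  have hip : ∀ m, IntegrableOn (fun x => φ m x ^ p) (unitCube n) := by
    intro m
    by_contra h
    have := h2 m
    rw [integral_undef h] at this
    linarith
  have hpsi := ((psi_cont p f F hp).tendsto _).comp h3
  rw [psi_zero p f F z hp hF (by linarith [hz.1]) hzeq] at hpsi
  have hGint : ∀ k, Tendsto (fun m => ∫ x in unitCube n,
      Gf p (mx n (φ m) (k + 1) x) (mx n (φ m) k x)) atTop (nhds 0) := fun k =>
    squeeze_zero (fun m => integral_nonneg (Gf_mx_nonneg n p hp (φ m) (hφ0 m) k))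
      (fun m => Gf_le_psi n p f F hp hF.le (φ m) (hφ0 m) (hφm m) (hi m) (hip m) (h1 m) (h2 m) k)
      hpsi
  have hG : ∀ k, ∀ x ∈ unitCube n, Tendsto (fun m =>
      Gf p (mx n (φ m) (k + 1) x) (mx n (φ m) k x)) atTop (nhds 0) := by
    intro k x hx
    have := (hGint k).const_mul ((2:ℝ) ^ (n * (k + 1)))
    rw [mul_zero] at this
    refine squeeze_zero (fun m => Gf_mx_nonneg n p hp (φ m) (hφ0 m) k x) (fun m => ?_) this
    refine le_integral_of_congr n (k + 1)
      (fun x => Gf p (mx n (φ m) (k + 1) x) (mx n (φ m) k x)) ?_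
      (Gf_mx_nonneg n p hp (φ m) (hφ0 m) k) (Gf_int n p hp (φ m) (hφ0 m) (hi m) k).1 x hx
    intro x y h
    have h' : idx n k x = idx n k y := by rw [idx_succ, idx_succ n k y, h]
    simp only [mx_congr n (φ m) _ _ _ h, mx_congr n (φ m) _ _ _ h']
  have hmx : ∀ k, ∀ x ∈ unitCube n, Tendsto (fun m => mx n (φ m) k x) atTop (nhds f) := by
    intro k x hx
    induction k with
    | zero =>
      simp only [mx_zero n _ x hx, h1]
      exact tendsto_const_nhds
    | succ k ih =>
      exact tendsto_of_Gf p f hp hfp _ _ (fun m => mx_mono n (φ m) x (Nat.le_succ k)) ih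
        (hG k x hx)
  have himx : ∀ k m, IntegrableOn (mx n (φ m) k) (unitCube n) := by
    intro k m
    simpa using int_mx_rpow n (φ m) (hφ0 m) (hi m) k 1 zero_le_one
  have hfinm := fin_unitCube n
  have hImx : ∀ k, Tendsto (fun m => ∫ x in unitCube n, mx n (φ m) k x) atTop (nhds f) := by
    intro k
    have := tendsto_integral_of_dominated_convergence (μ := volume.restrict (unitCube n))
      (F := fun m x => mx n (φ m) k x) (f := fun _ => f) (fun _ => 2 ^ (n * k) * f)
      (fun m => (meas_mx n (φ m) k).aestronglyMeasurable) (integrable_const _)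
      (fun m => Eventually.of_forall fun x => by
        rw [Real.norm_of_nonneg (mx_nonneg n (φ m) (hφ0 m) k x), ← h1 m]
        exact mx_le n (φ m) (hφ0 m) (hi m) k x)
      (by
        filter_upwards [ae_restrict_mem (meas_unitCube n)] with x hx
        exact hmx k x hx)
    rw [setIntegral_const, Measure.real, vol_unitCube, ENNReal.toReal_one, one_smul] at this
    exact this
  have hIav : ∀ k m, ∫ x in unitCube n, av n (φ m) k x = f := by
    intro k m
    have := integral_av_mul n k (φ m) (fun _ => 1) (fun _ _ _ => rfl)
      (by simpa using int_av n (φ m) (hφ0 m) (hi m) k) (by simpa using hi m)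
    simpa [h1 m] using this
  have hav : ∀ k, ∀ x ∈ unitCube n, Tendsto (fun m => av n (φ m) k x) atTop (nhds f) := by
    intro k x hx
    have hd : Tendsto (fun m => mx n (φ m) k x - av n (φ m) k x) atTop (nhds 0) := by
      have h := ((hImx k).sub_const f).const_mul ((2:ℝ) ^ (n * k))
      rw [sub_self, mul_zero] at h
      refine squeeze_zero (fun m => sub_nonneg.2 (av_le_mx n (φ m) k x)) (fun m => ?_) h
      have hk := le_integral_of_congr n k (fun x => mx n (φ m) k x - av n (φ m) k x)
        (fun x y hxy => by
          simp only [mx_congr n (φ m) _ _ _ hxy, av_congr n (φ m) _ _ _ hxy])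
        (fun x => sub_nonneg.2 (av_le_mx n (φ m) k x))
        ((himx k m).sub (int_av n (φ m) (hφ0 m) (hi m) k)) x hx
      rwa [integral_sub (himx k m) (int_av n (φ m) (hφ0 m) (hi m) k), hIav k m] at hk
    have := (hmx k x hx).sub hd
    simpa using this
  rintro I ⟨N, j, hj, hI⟩
  have hx : (fun i => (j i : ℝ) / 2 ^ N) ∈ I := by
    rw [hI]
    intro i _
    refine ⟨le_rfl, ?_⟩
    simp only
    gcongr
    linarith
  rw [← pc_eq n N j hj] at hI
  subst hI
  refine (hav N _ hx.1).congr fun m => ?_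
  unfold av
  rw [hx.2, vol_pc n N j hj, one_div, inv_inv]
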